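/- Let n ≥ 1, g ≥ 0, p ≥ 1. The map sending π ∈ ã_{g,p}(n) to the map π' : [n] → [n] defined by π'(u) := (π(2u)+1)/2 is well defined (π' is a permutation of [n]) and is a bijection from ã_{g,p}(n) onto â_{g,p}(n). -/

import Mathlib

open Equiv MeasureTheory ProbabilityTheory

noncomputable section

namespace RibbonNC

/-- The number of cycles `#(σ)` of a permutation, counted on the finite set `S`:
the number of orbits of `σ` meeting `S` (fixed points count as orbits). -/
def cyclesOn {α : Type*} (σ : Equiv.Perm α) (S : Finset α) : ℕ :=
  ((fun a => {b | σ.SameCycle a b}) '' (S : Set α)).ncard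

/-- `σ` is a permutation of `S`: it fixes everything outside `S`. -/
def IsPermOn {α : Type*} (σ : Equiv.Perm α) (S : Finset α) : Prop :=
  ∀ a ∉ S, σ a = a

/-- `σ` is a pairing of `S`: a fixed-point-free involution of `S`, fixing everything
outside `S`. -/
def IsPairingOn {α : Type*} (σ : Equiv.Perm α) (S : Finset α) : Prop :=
  σ * σ = 1 ∧ (∀ a ∈ S, σ a ≠ a) ∧ IsPermOn σ S

/-- `π` is non-crossing with respect to `γ` on `S`: the subgroup generated by `π` and `γ`
acts transitively on `S`, and `#(π) + #(π⁻¹γ) + #(γ) = |S| + 2`. -/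
def IsNoncrossingOn {α : Type*} (π γ : Equiv.Perm α) (S : Finset α) : Prop :=
  (∀ a ∈ S, ∀ b ∈ S, ∃ σ ∈ Subgroup.closure ({π, γ} : Set (Equiv.Perm α)), σ a = b) ∧
  cyclesOn π S + cyclesOn (π⁻¹ * γ) S + cyclesOn γ S = S.card + 2

/-- `[n] = {1, …, n}`, as a finset of integers. -/
def posSet (n : ℕ) : Finset ℤ := Finset.Icc 1 (n : ℤ)

/-- `±[n] = {−n, …, −1} ∪ {1, …, n}`, as a finset of integers. -/
def pmSet (n : ℕ) : Finset ℤ := Finset.Icc (-(n : ℤ)) (n : ℤ) \ {0}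

/-- The cyclic permutation `γ_n = (1, 2, …, n)` of `[n]`. -/
def gammaZ (n : ℕ) : Equiv.Perm ℤ := ((List.range n).map fun i => ((i : ℤ) + 1)).formPerm

/-- The permutation `γ̃_n = (1, 2, …, n)(−n, …, −2, −1)` of `±[n]`. -/
def gammaTildeZ (n : ℕ) : Equiv.Perm ℤ :=
  gammaZ n * ((List.range n).map fun i => ((i : ℤ) - (n : ℤ))).formPerm

/-- The involution `τ₀ : a ↦ −a` on `±[n]`, fixing everything outside. -/
def tau0 (n : ℕ) : Equiv.Perm ℤ :=
  ((List.range n).map fun i => Equiv.swap ((i : ℤ) + 1) (-((i : ℤ) + 1))).prod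

/-- The involution `τ₂` on `±[n]`, pairing `−k` with `k+1` for `1 ≤ k ≤ n−1`, and `−n`
with `1`. -/
def tau2 (n : ℕ) : Equiv.Perm ℤ :=
  ((List.range (n - 1)).map fun i => Equiv.swap (-((i : ℤ) + 1)) ((i : ℤ) + 2)).prod *
    Equiv.swap (-(n : ℤ)) 1

/-- The `δ`-condition for a permutation of `S = ±[n]`: no cycle of the form `(r, −r)`,
and together with every cycle `(r₁, …, r_s)`, the cycle `(−r_s, …, −r₁)` also occurs
(the latter is equivalent to `π(−a) = −π⁻¹(a)` for all `a`). -/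
def IsDeltaOn (π : Equiv.Perm ℤ) (S : Finset ℤ) : Prop :=
  (∀ r ∈ S, ¬(π r = -r ∧ π (-r) = r)) ∧ ∀ a : ℤ, π (-a) = -(π⁻¹ a)

/-- `a_g(n) = {π ∈ P₂(n) : #(π⁻¹γ_n) = n/2 + 1 − 2g}`. -/
def aSet (g n : ℕ) : Set (Equiv.Perm ℤ) :=
  {π | IsPairingOn π (posSet n) ∧ cyclesOn (π⁻¹ * gammaZ n) (posSet n) + 2 * g = n / 2 + 1}

/-- `b_k(n)`. -/
def bSet (k n : ℕ) : Set (Equiv.Perm ℤ) :=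
  {τ₁ | IsPairingOn τ₁ (pmSet n) ∧ cyclesOn (tau2 n * τ₁) (pmSet n) + 2 * k = n + 2 ∧
    tau0 n * τ₁ = τ₁ * tau0 n ∧ (∀ a ∈ pmSet n, (tau0 n * τ₁) a ≠ a) ∧
    ∃ a ∈ posSet n, τ₁ a ∈ posSet n}

/-- `NC₂^δ(n, −n)`, the symmetric non-crossing annular pairings of `±[n]`. -/
def ncDelta2 (n : ℕ) : Set (Equiv.Perm ℤ) :=
  {π | IsPairingOn π (pmSet n) ∧ IsNoncrossingOn π (gammaTildeZ n) (pmSet n) ∧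
    IsDeltaOn π (pmSet n)}

/-- `γ_{n,u,v} = γ_n · (u−1, v)`, with `(0, v)` read as `(n, v)` when `u = 1`. -/
def gammaUV (n : ℕ) (u v : ℤ) : Equiv.Perm ℤ :=
  gammaZ n * Equiv.swap (if u = 1 then (n : ℤ) else u - 1) v

/-- `NC₂^T_{u,v}(n)`. -/
def ncT2uv (n : ℕ) (u v : ℤ) : Set (Equiv.Perm ℤ) :=
  {π | IsPairingOn π (posSet n) ∧ IsNoncrossingOn π (gammaUV n u v) (posSet n) ∧
    π u = v ∧ ∀ a : ℤ, 1 ≤ a → a < u → π a ∈ posSet n ∧ ¬(u ≤ π a ∧ π a ≤ v)}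

/-- `NC₂^T(n)`. -/
def ncT2 (n : ℕ) : Set (Equiv.Perm ℤ) :=
  {π | ∃ u v : ℤ, 1 ≤ u ∧ u < v ∧ v < (n : ℤ) ∧ π ∈ ncT2uv n u v}

/-- `γ̃_{n,u,v} = γ̃_n · (−u, v−1) · (−v, u−1)`, with `(−v, 0)` read as `(−v, n)` when
`u = 1`. -/
def gammaTildeUV (n : ℕ) (u v : ℤ) : Equiv.Perm ℤ :=
  gammaTildeZ n * Equiv.swap (-u) (v - 1) *
    Equiv.swap (-v) (if u = 1 then (n : ℤ) else u - 1)

/-- `NC₂^K_{u,v}(n)`. -/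
def ncK2uv (n : ℕ) (u v : ℤ) : Set (Equiv.Perm ℤ) :=
  {π | IsPairingOn π (pmSet n) ∧ IsNoncrossingOn π (gammaTildeUV n u v) (pmSet n) ∧
    IsDeltaOn π (pmSet n) ∧ π u = -v ∧ ∀ a : ℤ, 1 ≤ a → a < u → π a ∈ posSet n}

/-- `NC₂^K(n)`. -/
def ncK2 (n : ℕ) : Set (Equiv.Perm ℤ) :=
  {π | ∃ u v : ℤ, 1 ≤ u ∧ u < v ∧ v < (n : ℤ) ∧ π ∈ ncK2uv n u v}

/-- The odd elements `{1, 3, …, 2n−1}` of `[2n]`. -/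
def oddPosSet (n : ℕ) : Finset ℤ := (posSet (2 * n)).filter fun a => Odd a

/-- `ã_{g,p}(n)`. -/
def aTildeSet (g p n : ℕ) : Set (Equiv.Perm ℤ) :=
  {π | π ∈ aSet g (2 * n) ∧ (∀ a ∈ posSet (2 * n), Even a → Odd (π a)) ∧
    cyclesOn (π⁻¹ * gammaZ (2 * n)) (oddPosSet n) = p}

/-- `B(n) = {1, 3, …, 2n−1} ∪ {−2, −4, …, −2n} ⊂ ±[2n]`. -/
def BSet (n : ℕ) : Finset ℤ :=
  (pmSet (2 * n)).filter fun a => (0 < a ∧ Odd a) ∨ (a < 0 ∧ Even a)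

/-- `W(n) = {2, 4, …, 2n} ∪ {−1, −3, …, −(2n−1)} ⊂ ±[2n]`. -/
def WSet (n : ℕ) : Finset ℤ :=
  (pmSet (2 * n)).filter fun a => (0 < a ∧ Even a) ∨ (a < 0 ∧ Odd a)

/-- `b̃_{k,p}(n)`. -/
def bTildeSet (k p n : ℕ) : Set (Equiv.Perm ℤ) :=
  {τ₁ | τ₁ ∈ bSet k (2 * n) ∧ (∀ a ∈ BSet n, τ₁ a ∈ BSet n) ∧
    cyclesOn (tau2 (2 * n) * τ₁) (WSet n) = 2 * p}

/-- `â_{g,p}(n) = {π ∈ S_{[n]} : #(π) = p, #(π⁻¹γ_n) = n − p + 1 − 2g}`. -/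
def aHatSet (g p n : ℕ) : Set (Equiv.Perm ℤ) :=
  {π | IsPermOn π (posSet n) ∧ cyclesOn π (posSet n) = p ∧
    cyclesOn (π⁻¹ * gammaZ n) (posSet n) + p + 2 * g = n + 1}

/-- `b̂_{k,p}(n)`. -/
def bHatSet (k p n : ℕ) : Set (Equiv.Perm ℤ) :=
  {τ₁ | IsPermOn τ₁ (pmSet n) ∧ cyclesOn τ₁ (pmSet n) = 2 * p ∧
    cyclesOn (gammaTildeZ n * τ₁) (pmSet n) + 2 * p + 2 * k = 2 * n + 2 ∧
    tau0 n * τ₁ * tau0 n = τ₁⁻¹ ∧ (∀ a ∈ pmSet n, (tau0 n * τ₁) a ≠ a) ∧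
    ∃ a ∈ posSet n, -(τ₁ a) ∈ posSet n}

/-- `ÑC₂^{δ,p}(2n, −2n)`. -/
def ncDelta2Tilde (p n : ℕ) : Set (Equiv.Perm ℤ) :=
  {π | π ∈ ncDelta2 (2 * n) ∧ (∀ a ∈ WSet n, π a ∈ BSet n) ∧
    cyclesOn (π⁻¹ * gammaTildeZ (2 * n)) (BSet n) = 2 * p}

/-- `ÑC₂^{T,p}(2n)`. -/
def ncT2Tilde (p n : ℕ) : Set (Equiv.Perm ℤ) :=
  {π | ∃ u v : ℤ, 1 ≤ u ∧ u < v ∧ v < (2 * n : ℤ) ∧ Odd (v - u) ∧ π ∈ ncT2uv (2 * n) u v ∧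
    (∀ a ∈ posSet (2 * n), Even a → Odd (π a)) ∧
    cyclesOn (π⁻¹ * gammaZ (2 * n)) (oddPosSet n) = p}

/-- `ÑC₂^{K,p}(2n)`. -/
def ncK2Tilde (p n : ℕ) : Set (Equiv.Perm ℤ) :=
  {π | ∃ u v : ℤ, 1 ≤ u ∧ u < v ∧ v < (2 * n : ℤ) ∧ Even (v - u) ∧ π ∈ ncK2uv (2 * n) u v ∧
    (∀ a ∈ WSet n, π a ∈ BSet n) ∧
    cyclesOn (π⁻¹ * gammaTildeZ (2 * n)) (BSet n) = 2 * p}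

/-- `NC^{T,p}(n)` (non-crossing annular permutations, toroidal case). -/
def ncTPerm (p n : ℕ) : Set (Equiv.Perm ℤ) :=
  {π | ∃ u v : ℤ, 1 ≤ u ∧ u < v ∧ v < (n : ℤ) ∧ IsPermOn π (posSet n) ∧
    IsNoncrossingOn π (gammaUV n u v) (posSet n) ∧ π⁻¹ u = v ∧
    cyclesOn π (posSet n) = p ∧
    ∀ a : ℤ, 1 ≤ a → a < u → π⁻¹ a ∈ posSet n ∧ ¬(u ≤ π⁻¹ a ∧ π⁻¹ a ≤ v)}

/-- `NC^{δ,p}(n, −n)` (symmetric non-crossing annular permutations). -/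
def ncDeltaPerm (p n : ℕ) : Set (Equiv.Perm ℤ) :=
  {π | IsPermOn π (pmSet n) ∧ IsNoncrossingOn π (gammaTildeZ n) (pmSet n) ∧
    IsDeltaOn π (pmSet n) ∧ cyclesOn π (pmSet n) = 2 * p}

/-- `NC^{K,p}(n)` (non-crossing annular permutations, Klein bottle case). -/
def ncKPerm (p n : ℕ) : Set (Equiv.Perm ℤ) :=
  {π | ∃ u v : ℤ, 1 ≤ u ∧ u < v ∧ v < (n : ℤ) ∧ IsPermOn π (pmSet n) ∧
    IsNoncrossingOn π (gammaTildeUV n u v) (pmSet n) ∧ IsDeltaOn π (pmSet n) ∧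
    π u = -v ∧ cyclesOn π (pmSet n) = 2 * p ∧
    ∀ a : ℤ, 1 ≤ a → a < u → π⁻¹ a ∈ posSet n}


theorem perm_inv_apply {α : Type*} (σ : Equiv.Perm α) (a : α) : σ⁻¹ (σ a) = a :=
  σ.symm_apply_apply a

theorem perm_apply_inv {α : Type*} (σ : Equiv.Perm α) (a : α) : σ (σ⁻¹ a) = a :=
  σ.apply_symm_apply a

theorem gammaZ_eq (n : ℕ) :
    gammaZ n = ((List.range n).map fun i : ℕ => ((i : ℤ) + 1)).formPerm := by
  unfold gammaZ
  congr 1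
  simp only [List.pure_def, List.bind_eq_flatMap, List.map_flatMap, List.map_cons, List.map_nil]
  induction List.range n with
  | nil => rfl
  | cons x l ih => simp [ih]

theorem gammaZ_apply (n : ℕ) (hn : 1 ≤ n) (a : ℤ) :
    gammaZ n a = if 1 ≤ a ∧ a < n then a + 1 else if a = n then 1 else a := by
  have hnd : ((List.range n).map fun i : ℕ => ((i : ℤ) + 1)).Nodup := by
    refine List.Nodup.map ?_ List.nodup_range
    intro x y h
    simpa using h
  rw [gammaZ_eq]
  by_cases h : 1 ≤ a ∧ a ≤ n
  · obtain ⟨k, rfl⟩ : ∃ k : ℕ, a = k + 1 := ⟨(a - 1).toNat, by omega⟩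
    have hk : k < n := by omega
    have := List.formPerm_apply_getElem _ hnd k (by simpa using hk)
    simp only [List.getElem_map, List.getElem_range, List.length_map, List.length_range] at this
    rw [this]
    by_cases h2 : k + 1 < n
    · rw [Nat.mod_eq_of_lt h2, if_pos (by omega)]
      push_cast; rfl
    · have h3 : k + 1 = n := by omega
      rw [if_neg (by omega), if_pos (by omega), h3]
      simp
  · rw [if_neg (by omega), if_neg (by omega)]
    apply List.formPerm_apply_of_notMem
    simp only [List.mem_map, List.mem_range, not_exists, not_and]
    intro x hx hxa
    omega

theorem mem_posSet (n : ℕ) (a : ℤ) : a ∈ posSet n ↔ 1 ≤ a ∧ a ≤ n := by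
  simp [posSet]

theorem zpow_semiconj {α β : Type*} (σ : Equiv.Perm α) (τ : Equiv.Perm β) (f : α → β)
    (h : ∀ a, τ (f a) = f (σ a)) (k : ℤ) (a : α) : (τ ^ k) (f a) = f ((σ ^ k) a) := by
  have hn : ∀ (m : ℕ) (a : α), (τ ^ m) (f a) = f ((σ ^ m) a) := by
    intro m
    induction m with
    | zero => intro a; simp
    | succ m ih => intro a; rw [pow_succ, pow_succ, Perm.mul_apply, Perm.mul_apply, h, ih]
  cases k with
  | ofNat m => simpa using hn m a
  | negSucc m =>
    rw [zpow_negSucc, zpow_negSucc, Perm.inv_eq_iff_eq, hn, perm_apply_inv]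

theorem cyclesOn_image {α β : Type*} [DecidableEq β] (σ : Equiv.Perm α) (τ : Equiv.Perm β)
    (f : α → β) (hf : Function.Injective f)
    (h : ∀ a, τ (f a) = f (σ a)) (S : Finset α) : cyclesOn τ (S.image f) = cyclesOn σ S := by
  have hs : ∀ a b, τ.SameCycle (f a) (f b) ↔ σ.SameCycle a b := by
    intro a b
    refine exists_congr fun k => ?_
    rw [zpow_semiconj σ τ f h, hf.eq_iff]
  unfold cyclesOn
  have h1 : ∀ a, f ⁻¹' {b | τ.SameCycle (f a) b} = {b | σ.SameCycle a b} := by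
    intro a; ext b; exact hs a b
  have h2 : ((fun a => {b | σ.SameCycle a b}) '' (S : Set α)) =
      (fun X => f ⁻¹' X) '' ((fun a => {b | τ.SameCycle a b}) '' ((S.image f : Finset β) : Set β)) := by
    rw [Finset.coe_image, Set.image_image, Set.image_image]
    simp only [h1]
  rw [h2]
  refine (Set.InjOn.ncard_image ?_).symm
  rintro X ⟨x, hx, rfl⟩ Y ⟨y, hy, rfl⟩ hXY
  rw [Finset.coe_image] at hx hy
  obtain ⟨a, -, rfl⟩ := hx
  obtain ⟨b, -, rfl⟩ := hy
  simp only [h1] at hXY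
  have hab : σ.SameCycle a b := by
    have : b ∈ {c | σ.SameCycle a c} := by rw [hXY]; exact Perm.SameCycle.refl _ _
    exact this
  have := (hs a b).2 hab
  ext c
  exact ⟨fun hc => this.symm.trans hc, fun hc => this.trans hc⟩

theorem cyclesOn_union {α : Type*} [DecidableEq α] (σ : Equiv.Perm α) (S T : Finset α)
    (h : ∀ a ∈ S, ∀ b ∈ T, ¬ σ.SameCycle a b) :
    cyclesOn σ (S ∪ T) = cyclesOn σ S + cyclesOn σ T := by
  unfold cyclesOn
  rw [Finset.coe_union, Set.image_union, Set.ncard_union_eq]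
  · rw [Set.disjoint_left]
    rintro X ⟨a, ha, rfl⟩ ⟨b, hb, hX⟩
    refine h a ha b hb ?_
    have : b ∈ {c | σ.SameCycle a c} := by
      simp only at hX
      rw [← hX]; exact Perm.SameCycle.refl _ _
    exact this

/-- `π` and `ρ` correspond to each other. -/
def Corr (n : ℕ) (π ρ : Equiv.Perm ℤ) : Prop :=
  IsPermOn ρ (posSet n) ∧ IsPermOn π (posSet (2 * n)) ∧
  (∀ u ∈ posSet n, π (2 * u) = 2 * ρ u - 1) ∧
  (∀ u ∈ posSet n, π (2 * u - 1) = 2 * ρ⁻¹ u)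

theorem permOn_mem {n : ℕ} {ρ : Equiv.Perm ℤ} (h : IsPermOn ρ (posSet n)) {u : ℤ}
    (hu : u ∈ posSet n) : ρ u ∈ posSet n := by
  by_contra hc
  have := ρ.injective (h _ hc)
  rw [this] at hc
  exact hc hu

theorem permOn_inv {n : ℕ} {ρ : Equiv.Perm ℤ} (h : IsPermOn ρ (posSet n)) :
    IsPermOn ρ⁻¹ (posSet n) := by
  intro a ha
  rw [Perm.inv_eq_iff_eq, h a ha]

theorem Corr.invol {n : ℕ} {π ρ : Equiv.Perm ℤ} (h : Corr n π ρ) : π * π = 1 := by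
  obtain ⟨h1, h2, h3, h4⟩ := h
  ext a
  rw [Perm.mul_apply, Perm.one_apply]
  by_cases ha : a ∈ posSet (2 * n)
  · rw [mem_posSet] at ha
    push_cast at ha
    rcases Int.even_or_odd' a with ⟨k, rfl | rfl⟩
    · have hk : k ∈ posSet n := by rw [mem_posSet]; omega
      rw [h3 k hk, h4 _ (permOn_mem h1 hk), perm_inv_apply]
    · have hk : k + 1 ∈ posSet n := by rw [mem_posSet]; omega
      have e : 2 * k + 1 = 2 * (k + 1) - 1 := by ring
      rw [e, h4 _ hk, h3 _ (permOn_mem (permOn_inv h1) hk), perm_apply_inv]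
  · rw [h2 a ha, h2 a ha]

theorem Corr.pairing {n : ℕ} {π ρ : Equiv.Perm ℤ} (h : Corr n π ρ) :
    IsPairingOn π (posSet (2 * n)) := by
  refine ⟨h.invol, ?_, h.2.1⟩
  obtain ⟨h1, h2, h3, h4⟩ := h
  intro a ha
  rw [mem_posSet] at ha
  push_cast at ha
  rcases Int.even_or_odd' a with ⟨k, rfl | rfl⟩
  · have hk : k ∈ posSet n := by rw [mem_posSet]; omega
    rw [h3 k hk]; omega
  · have hk : k + 1 ∈ posSet n := by rw [mem_posSet]; omega
    have e : 2 * k + 1 = 2 * (k + 1) - 1 := by ring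
    rw [e, h4 _ hk]; omega

theorem Corr.odd {n : ℕ} {π ρ : Equiv.Perm ℤ} (h : Corr n π ρ) :
    ∀ a ∈ posSet (2 * n), Even a → Odd (π a) := by
  obtain ⟨h1, h2, h3, h4⟩ := h
  intro a ha he
  rw [mem_posSet] at ha
  push_cast at ha
  obtain ⟨k, rfl⟩ := he.two_dvd
  have hk : k ∈ posSet n := by rw [mem_posSet]; omega
  rw [h3 k hk]
  exact ⟨ρ k - 1, by ring⟩

theorem Corr.semi_odd {n : ℕ} (hn : 1 ≤ n) {π ρ : Equiv.Perm ℤ} (h : Corr n π ρ) (u : ℤ) :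
    (π⁻¹ * gammaZ (2 * n)) (2 * u - 1) = 2 * ρ u - 1 := by
  have hi : π⁻¹ = π := inv_eq_of_mul_eq_one_left h.invol
  obtain ⟨h1, h2, h3, h4⟩ := h
  rw [hi, Perm.mul_apply, gammaZ_apply _ (by omega)]
  push_cast
  by_cases hu : u ∈ posSet n
  · rw [← h3 u hu]
    rw [mem_posSet] at hu
    rw [if_pos (by omega)]
    congr 1; ring
  · rw [h1 u hu]
    rw [mem_posSet] at hu
    rw [if_neg (by omega), if_neg (by omega)]
    apply h2
    rw [mem_posSet]; push_cast; omega

theorem Corr.semi_even {n : ℕ} (hn : 1 ≤ n) {π ρ : Equiv.Perm ℤ} (h : Corr n π ρ) (u : ℤ) :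
    (π⁻¹ * gammaZ (2 * n)) (2 * u) = 2 * (ρ⁻¹ * gammaZ n) u := by
  have hi : π⁻¹ = π := inv_eq_of_mul_eq_one_left h.invol
  obtain ⟨h1, h2, h3, h4⟩ := h
  rw [hi, Perm.mul_apply, Perm.mul_apply, gammaZ_apply _ (by omega), gammaZ_apply _ hn]
  push_cast
  by_cases hu : u ∈ posSet n
  · rw [mem_posSet] at hu
    by_cases hun : u = n
    · rw [if_neg (by omega), if_pos (by omega), if_neg (by omega), if_pos (by omega)]
      rw [← h4 1 (by rw [mem_posSet]; omega)]
      norm_num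
    · rw [if_pos (by omega), if_pos (by omega)]
      rw [← h4 (u + 1) (by rw [mem_posSet]; omega)]
      congr 1; ring
  · have hu' := hu
    rw [mem_posSet] at hu
    rw [if_neg (by omega), if_neg (by omega), if_neg (by omega), if_neg (by omega),
      permOn_inv h1 u hu']
    apply h2
    rw [mem_posSet]; push_cast; omega

theorem oddPosSet_eq (n : ℕ) : oddPosSet n = (posSet n).image fun u => 2 * u - 1 := by
  ext a
  simp only [oddPosSet, Finset.mem_filter, Finset.mem_image, mem_posSet]
  push_cast
  constructor
  · rintro ⟨h, k, rfl⟩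
    exact ⟨k + 1, by omega, by ring⟩
  · rintro ⟨u, h, rfl⟩
    exact ⟨by omega, u - 1, by ring⟩

theorem posSet_two_mul (n : ℕ) :
    posSet (2 * n) = oddPosSet n ∪ (posSet n).image fun u => 2 * u := by
  rw [oddPosSet_eq]
  ext a
  simp only [Finset.mem_union, Finset.mem_image, mem_posSet]
  push_cast
  constructor
  · intro h
    rcases Int.even_or_odd' a with ⟨k, rfl | rfl⟩
    · exact Or.inr ⟨k, by omega, rfl⟩
    · exact Or.inl ⟨k + 1, by omega, by ring⟩
  · rintro (⟨u, h, rfl⟩ | ⟨u, h, rfl⟩) <;> omega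

theorem Corr.cycles_odd {n : ℕ} (hn : 1 ≤ n) {π ρ : Equiv.Perm ℤ} (h : Corr n π ρ) :
    cyclesOn (π⁻¹ * gammaZ (2 * n)) (oddPosSet n) = cyclesOn ρ (posSet n) := by
  rw [oddPosSet_eq]
  refine cyclesOn_image ρ _ (fun u : ℤ => 2 * u - 1) ?_ (h.semi_odd hn) _
  intro x y hxy
  simp only at hxy
  omega

theorem Corr.cycles {n : ℕ} (hn : 1 ≤ n) {π ρ : Equiv.Perm ℤ} (h : Corr n π ρ) :
    cyclesOn (π⁻¹ * gammaZ (2 * n)) (posSet (2 * n)) =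
      cyclesOn ρ (posSet n) + cyclesOn (ρ⁻¹ * gammaZ n) (posSet n) := by
  rw [posSet_two_mul, cyclesOn_union, h.cycles_odd hn]
  · congr 1
    refine cyclesOn_image (ρ⁻¹ * gammaZ n) _ (fun u : ℤ => 2 * u) ?_ (h.semi_even hn) _
    intro x y hxy
    simp only at hxy
    omega
  · rw [oddPosSet_eq]
    intro a ha b hb
    rw [Finset.mem_image] at ha hb
    obtain ⟨u, -, rfl⟩ := ha
    obtain ⟨v, -, rfl⟩ := hb
    rintro ⟨k, hk⟩
    rw [zpow_semiconj ρ _ (fun u : ℤ => 2 * u - 1) (h.semi_odd hn)] at hk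
    omega

theorem Corr.mem_iff {n : ℕ} (hn : 1 ≤ n) (g p : ℕ) {π ρ : Equiv.Perm ℤ} (h : Corr n π ρ) :
    π ∈ aTildeSet g p n ↔ ρ ∈ aHatSet g p n := by
  have e : 2 * n / 2 = n := by omega
  simp only [aTildeSet, aSet, aHatSet, Set.mem_ofPred_eq, h.cycles hn, h.cycles_odd hn, e]
  constructor
  · rintro ⟨⟨-, h1⟩, -, h2⟩
    exact ⟨h.1, h2, by omega⟩
  · rintro ⟨-, h2, h1⟩
    exact ⟨⟨h.pairing, by omega⟩, h.odd, h2⟩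

theorem exists_hat {g p n : ℕ} {π : Equiv.Perm ℤ} (h : π ∈ aTildeSet g p n) :
    ∃ ρ, Corr n π ρ := by
  obtain ⟨⟨⟨hinv, hfp, hperm⟩, -⟩, hodd, -⟩ := h
  have hii : ∀ a, π (π a) = a := fun a => by
    rw [← Perm.mul_apply, hinv, Perm.one_apply]
  have hE : ∀ u ∈ posSet n, ∃ v ∈ posSet n, π (2 * u) = 2 * v - 1 := by
    intro u hu
    have hu2 : 2 * u ∈ posSet (2 * n) := by
      rw [mem_posSet] at hu ⊢; push_cast; omega
    obtain ⟨k, hk⟩ := hodd _ hu2 (even_two_mul u)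
    have := permOn_mem hperm hu2
    rw [hk, mem_posSet] at this
    push_cast at this
    exact ⟨k + 1, by rw [mem_posSet]; omega, by rw [hk]; ring⟩
  choose! f hf hf2 using hE
  have hinj : Set.InjOn f (posSet n) := by
    intro x hx y hy hxy
    have := hf2 x hx
    rw [hxy, ← hf2 y hy] at this
    have := π.injective this
    omega
  have hsurj : ∀ v ∈ posSet n, ∃ u ∈ posSet n, f u = v := by
    have := Finset.surjOn_of_injOn_of_card_le f (s := posSet n) (t := posSet n) hf hinj le_rfl
    intro v hv
    obtain ⟨u, hu, h⟩ := this hv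
    exact ⟨u, hu, h⟩
  choose! e he he2 using hsurj
  have he3 : ∀ u ∈ posSet n, e (f u) = u := fun u hu =>
    hinj (he _ (hf u hu)) hu (he2 _ (hf u hu))
  let ρ : Equiv.Perm ℤ :=
    { toFun := fun u => if u ∈ posSet n then f u else u
      invFun := fun u => if u ∈ posSet n then e u else u
      left_inv := by
        intro u
        by_cases hu : u ∈ posSet n
        · simp [hu, hf u hu, he3 u hu]
        · simp [hu]
      right_inv := by
        intro u
        by_cases hu : u ∈ posSet n
        · simp [hu, he u hu, he2 u hu]
        · simp [hu] }
  have hρ : ∀ u ∈ posSet n, ρ u = f u := fun u hu => if_pos hu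
  have hρ' : ∀ u ∈ posSet n, ρ⁻¹ u = e u := fun u hu => if_pos hu
  refine ⟨ρ, fun a ha => if_neg ha, hperm, ?_, ?_⟩
  · intro u hu
    rw [hρ u hu, hf2 u hu]
  · intro u hu
    rw [hρ' u hu]
    have := hf2 _ (he u hu)
    rw [he2 u hu] at this
    rw [← this, hii]

theorem exists_tilde {n : ℕ} {ρ : Equiv.Perm ℤ} (h : IsPermOn ρ (posSet n)) :
    ∃ π, Corr n π ρ := by
  let f : ℤ → ℤ := fun a => if a ∈ posSet (2 * n) then
    (if a % 2 = 0 then 2 * ρ (a / 2) - 1 else 2 * ρ⁻¹ ((a + 1) / 2)) else a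
  have hf1 : ∀ u ∈ posSet n, f (2 * u) = 2 * ρ u - 1 := by
    intro u hu
    have h2 : 2 * u ∈ posSet (2 * n) := by
      rw [mem_posSet] at hu ⊢; push_cast; omega
    have e : 2 * u / 2 = u := by omega
    simp only [f]
    rw [if_pos h2, if_pos (by omega), e]
  have hf2 : ∀ u ∈ posSet n, f (2 * u - 1) = 2 * ρ⁻¹ u := by
    intro u hu
    have h2 : 2 * u - 1 ∈ posSet (2 * n) := by
      rw [mem_posSet] at hu ⊢; push_cast; omega
    have e : (2 * u - 1 + 1) / 2 = u := by omega
    simp only [f]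
    rw [if_pos h2, if_neg (by omega), e]
  have hf3 : ∀ a ∉ posSet (2 * n), f a = a := fun a ha => if_neg ha
  have hff : Function.Involutive f := by
    intro a
    by_cases ha : a ∈ posSet (2 * n)
    · rw [mem_posSet] at ha
      push_cast at ha
      rcases Int.even_or_odd' a with ⟨k, rfl | rfl⟩
      · have hk : k ∈ posSet n := by rw [mem_posSet]; omega
        rw [hf1 k hk, hf2 _ (permOn_mem h hk), perm_inv_apply]
      · have hk : k + 1 ∈ posSet n := by rw [mem_posSet]; omega
        have e : 2 * k + 1 = 2 * (k + 1) - 1 := by ring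
        rw [e, hf2 _ hk, hf1 _ (permOn_mem (permOn_inv h) hk), perm_apply_inv]
    · rw [hf3 a ha, hf3 a ha]
  exact ⟨hff.toPerm, h, hf3, hf1, hf2⟩

theorem Corr.unique_right {n : ℕ} {π ρ ρ' : Equiv.Perm ℤ} (h : Corr n π ρ) (h' : Corr n π ρ') :
    ρ = ρ' := by
  ext u
  by_cases hu : u ∈ posSet n
  · have h1 := h.2.2.1 u hu
    rw [h'.2.2.1 u hu] at h1
    omega
  · rw [h.1 u hu, h'.1 u hu]

theorem Corr.unique_left {n : ℕ} {π π' ρ : Equiv.Perm ℤ} (h : Corr n π ρ) (h' : Corr n π' ρ) :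
    π = π' := by
  ext a
  by_cases ha : a ∈ posSet (2 * n)
  · rw [mem_posSet] at ha
    push_cast at ha
    rcases Int.even_or_odd' a with ⟨k, rfl | rfl⟩
    · have hk : k ∈ posSet n := by rw [mem_posSet]; omega
      rw [h.2.2.1 k hk, h'.2.2.1 k hk]
    · have hk : k + 1 ∈ posSet n := by rw [mem_posSet]; omega
      have e : 2 * k + 1 = 2 * (k + 1) - 1 := by ring
      rw [e, h.2.2.2 _ hk, h'.2.2.2 _ hk]
  · rw [h.2.1 a ha, h'.2.1 a ha]

/-- For `n ≥ 1`, `g ≥ 0`, `p ≥ 1`, the map sending `π ∈ ã_{g,p}(n)` to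
`π' : [n] → [n]`, `π'(u) = (π(2u) + 1)/2`, is well defined (`π'` is a permutation of `[n]`)
and is a bijection from `ã_{g,p}(n)` onto `â_{g,p}(n)`. -/
theorem bijection_aTilde_aHat (n g p : ℕ) (hn : 1 ≤ n) (hp : 1 ≤ p) :
    ∃ Φ : Equiv.Perm ℤ → Equiv.Perm ℤ,
      (∀ π ∈ aTildeSet g p n,
        (∀ u ∈ posSet n, Φ π u = (π (2 * u) + 1) / 2) ∧ IsPermOn (Φ π) (posSet n)) ∧
      Set.BijOn Φ (aTildeSet g p n) (aHatSet g p n) := by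
  choose! Φ hΦ using fun (π : Equiv.Perm ℤ) (h : π ∈ aTildeSet g p n) => exists_hat h
  refine ⟨Φ, ?_, ?_, ?_, ?_⟩
  · intro π hπ
    refine ⟨fun u hu => ?_, (hΦ π hπ).1⟩
    rw [(hΦ π hπ).2.2.1 u hu]
    omega
  · intro π hπ
    exact ((hΦ π hπ).mem_iff hn g p).1 hπ
  · intro π hπ π' hπ' he
    have h1 := hΦ π hπ
    rw [he] at h1
    exact h1.unique_left (hΦ π' hπ')
  · intro ρ hρ
    obtain ⟨π, hc⟩ := exists_tilde hρ.1
    have hπ := (hc.mem_iff hn g p).2 hρ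
    exact ⟨π, hπ, (hΦ π hπ).unique_right hc⟩

end RibbonNC
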